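/- The group of affine transformations z ↦ g·z·gᵀ + i·v acts transitively on the tube 𝒯 over the future light cone: for any two matrices z, w ∈ 𝒯 there exist an invertible matrix g ∈ GL(2,ℝ) and a real symmetric 2×2 matrix v (both regarded as complex matrices) such that w = g·z·gᵀ + i·v. -/

import Mathlib

open Matrix Complex

/-- The tube `𝒯` over the future light cone, inside the space of symmetric
complex `2×2` matrices. -/
def lightConeTube : Set (Matrix (Fin 2) (Fin 2) ℂ) :=
  {z | zᵀ = z ∧ (z + z.map (starRingEnd ℂ)).det = 0 ∧ 0 < (Matrix.trace z).re}

lemma tube_param (z : Matrix (Fin 2) (Fin 2) ℂ) (hz : z ∈ lightConeTube) :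
    ∃ a b : ℝ, 0 < a ^ 2 + b ^ 2 ∧ z 1 0 = z 0 1 ∧ (z 0 0).re = a ^ 2 ∧
      (z 0 1).re = a * b ∧ (z 1 1).re = b ^ 2 := by
  obtain ⟨h1, h2, h3⟩ := hz
  have hs : z 1 0 = z 0 1 := congrFun (congrFun h1 0) 1
  rw [Matrix.det_fin_two] at h2
  simp only [Matrix.add_apply, Matrix.map_apply, hs, Complex.add_conj] at h2
  rw [Matrix.trace_fin_two, Complex.add_re] at h3
  norm_cast at h2
  generalize (z 0 0).re = x at *
  generalize (z 1 1).re = y at *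
  generalize (z 0 1).re = t at *
  have hd : x * y = t ^ 2 := by linarith
  have hx : 0 ≤ x := by
    by_contra hx
    nlinarith [sq_nonneg t]
  rcases hx.eq_or_lt with h0 | h0
  · subst h0
    have ht : t = 0 := by
      apply pow_eq_zero_iff (two_ne_zero) |>.1
      linarith
    have hy := Real.sq_sqrt (show 0 ≤ y by linarith)
    refine ⟨0, √y, by rw [hy]; linarith, hs, by simp, by simp [ht], hy.symm⟩
  · have hq := Real.sq_sqrt hx
    have hp := Real.sqrt_pos.2 h0
    refine ⟨√x, t / √x, by positivity, hs, hq.symm, by field_simp, ?_⟩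
    rw [div_pow, hq, ← hd]
    field_simp

/-- The group of affine transformations `z ↦ g z gᵀ + i v`, with `g ∈ GL(2,ℝ)` and
`v` real symmetric, acts transitively on the tube `𝒯` over the future light cone. -/
theorem affine_transitive_on_tube (z w : Matrix (Fin 2) (Fin 2) ℂ)
    (hz : z ∈ lightConeTube) (hw : w ∈ lightConeTube) :
    ∃ (g v : Matrix (Fin 2) (Fin 2) ℝ), IsUnit g ∧ vᵀ = v ∧
      w = (g.map (Complex.ofReal)) * z * (g.map (Complex.ofReal))ᵀ
          + Complex.I • (v.map (Complex.ofReal)) := by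
  obtain ⟨a, b, hab, zs, z0, z1, z2⟩ := tube_param z hz
  obtain ⟨c, d, hcd, ws, w0, w1, w2⟩ := tube_param w hw
  obtain ⟨p, q, hc, hd⟩ : ∃ p q : ℝ, c = p * a - q * b ∧ d = q * a + p * b := by
    refine ⟨(a * c + b * d) / (a ^ 2 + b ^ 2), (a * d - b * c) / (a ^ 2 + b ^ 2), ?_, ?_⟩
    · field_simp
      ring
    · field_simp
      ring
  have hpq : p * p - -q * q ≠ 0 := by
    intro h
    have : c ^ 2 + d ^ 2 = (p * p - -q * q) * (a ^ 2 + b ^ 2) := by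
      rw [hc, hd]; ring
    rw [h] at this
    linarith
  have zi : (z 1 0).im = (z 0 1).im := by rw [zs]
  have wi : (w 1 0).im = (w 0 1).im := by rw [ws]
  have zr : (z 1 0).re = a * b := by rw [zs, z1]
  have wr : (w 1 0).re = c * d := by rw [ws, w1]
  subst hc hd
  let g : Matrix (Fin 2) (Fin 2) ℝ := !![p, -q; q, p]
  let y : Matrix (Fin 2) (Fin 2) ℝ := z.map Complex.im
  refine ⟨g, w.map Complex.im - g * y * gᵀ, ?_, ?_, ?_⟩
  · rw [Matrix.isUnit_iff_isUnit_det, isUnit_iff_ne_zero, Matrix.det_fin_two_of]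
    exact hpq
  · ext i j
    fin_cases i <;> fin_cases j <;>
      simp [g, y, Matrix.mul_apply, Matrix.vecMul, dotProduct, Fin.sum_univ_two, zi, wi] <;> ring
  · ext i j
    fin_cases i <;> fin_cases j <;> apply Complex.ext <;>
      simp [g, y, Matrix.mul_apply, Matrix.vecMul, dotProduct, Fin.sum_univ_two, zi, wi, z0, z1, z2, zr, w0, w1, w2, wr] <;>
      ring
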